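/- There exists a constant c > 0 such that for every R > 1 and every x ∈ ℝ⁴ with R < |x| < 2R, one has ∫_{{y ∈ ℝ⁴ : R < |y| < 2R}} ⟨x⟩^{-3}⟨|x|−|y|⟩^{-1} dy ≥ c·log⟨R⟩. Consequently, the integral operator on ℝ⁴ with kernel K(x,y) = ⟨x⟩^{-3}⟨|x|−|y|⟩^{-1} for (1/2)|x| ≤ |y| ≤ 2|x| and K(x,y) = 0 otherwise is not bounded on L^p(ℝ⁴) for any 1 ≤ p ≤ ∞. -/

import Mathlib

open MeasureTheory Real
open scoped ENNReal

/-- The Japanese bracket `⟨x⟩ = (1+|x|²)^{1/2}` on Euclidean space. -/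
noncomputable def jb {n : ℕ} (x : EuclideanSpace ℝ (Fin n)) : ℝ := Real.sqrt (1 + ‖x‖ ^ 2)

/-- The Japanese bracket `⟨t⟩ = (1+t²)^{1/2}` on the real line. -/
noncomputable def jbr (t : ℝ) : ℝ := Real.sqrt (1 + t ^ 2)

/-- The borderline annular kernel `K(x,y) = ⟨x⟩⁻³⟨|x|-|y|⟩⁻¹` supported where
`|x|/2 ≤ |y| ≤ 2|x|`. -/
noncomputable def K6 (x y : EuclideanSpace ℝ (Fin 4)) : ℝ :=
  if ‖x‖ / 2 ≤ ‖y‖ ∧ ‖y‖ ≤ 2 * ‖x‖ then jb x ^ (-3 : ℝ) * jbr (‖x‖ - ‖y‖) ^ (-1 : ℝ) else 0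

lemma jbr_pos6 (t : ℝ) : 0 < jbr t := Real.sqrt_pos.2 (by positivity)

lemma arsinh_ge6 (a : ℝ) (ha : 0 ≤ a) : Real.log (1 + a) ≤ Real.arsinh a := by
  unfold Real.arsinh
  apply Real.log_le_log (by linarith)
  have : (1 : ℝ) ≤ √(1 + a ^ 2) := by
    rw [Real.one_le_sqrt]; nlinarith
  linarith

lemma int_ker6 (s a b : ℝ) :
    ∫ r in a..b, jbr (s - r) ^ (-1 : ℝ) = Real.arsinh (b - s) + Real.arsinh (s - a) := by
  have h : ∀ r ∈ Set.uIcc a b, HasDerivAt (fun r => Real.arsinh (r - s)) (jbr (s - r) ^ (-1 : ℝ)) r := by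
    intro r _
    have h1 := (Real.hasDerivAt_arsinh (r - s)).comp r ((hasDerivAt_id r).sub_const s)
    have e : jbr (s - r) ^ (-1 : ℝ) = (√(1 + (r - s) ^ 2))⁻¹ * 1 := by
      rw [Real.rpow_neg_one, jbr, mul_one, show (s - r) ^ 2 = (r - s) ^ 2 by ring]
    rw [e]
    exact h1
  rw [intervalIntegral.integral_eq_sub_of_hasDerivAt h]
  · rw [show a - s = -(s - a) by ring, Real.arsinh_neg]; ring
  · apply Continuous.intervalIntegrable
    simp only [Real.rpow_neg_one]
    apply Continuous.inv₀
    · unfold jbr; fun_prop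
    · intro r; exact (jbr_pos6 _).ne'

lemma main6 (R : ℝ) (hR : 1 < R) (x : EuclideanSpace ℝ (Fin 4)) (h1 : R < ‖x‖) (h2 : ‖x‖ < 2 * R) :
    (4 * volume.real (Metric.ball (0 : EuclideanSpace ℝ (Fin 4)) 1) / 27) * Real.log (jbr R) ≤
          ∫ y in {y : EuclideanSpace ℝ (Fin 4) | R < ‖y‖ ∧ ‖y‖ < 2 * R},
            jb x ^ (-3 : ℝ) * jbr (‖x‖ - ‖y‖) ^ (-1 : ℝ) := by
  set ω := volume.real (Metric.ball (0 : EuclideanSpace ℝ (Fin 4)) 1) with hω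
  have hω0 : 0 ≤ ω := measureReal_nonneg
  have hcont : Continuous (fun r : ℝ => jbr (‖x‖ - r) ^ (-1 : ℝ)) := by
    simp only [Real.rpow_neg_one]
    apply Continuous.inv₀
    · unfold jbr; fun_prop
    · intro r; exact (jbr_pos6 _).ne'
  have hm : MeasurableSet {y : EuclideanSpace ℝ (Fin 4) | R < ‖y‖ ∧ ‖y‖ < 2 * R} := by
    measurability
  have e1 : ∫ y in {y : EuclideanSpace ℝ (Fin 4) | R < ‖y‖ ∧ ‖y‖ < 2 * R},
            jbr (‖x‖ - ‖y‖) ^ (-1 : ℝ) = 4 * ω * ∫ r in R..(2*R), r ^ 3 * jbr (‖x‖ - r) ^ (-1 : ℝ) := by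
    rw [← integral_indicator hm]
    have := integral_fun_norm_addHaar (volume : Measure (EuclideanSpace ℝ (Fin 4)))
      ((Set.Ioo R (2*R)).indicator (fun r : ℝ => jbr (‖x‖ - r) ^ (-1 : ℝ)))
    have e : (fun y : EuclideanSpace ℝ (Fin 4) => (Set.Ioo R (2*R)).indicator (fun r : ℝ => jbr (‖x‖ - r) ^ (-1 : ℝ)) ‖y‖)
       = Set.indicator {y : EuclideanSpace ℝ (Fin 4) | R < ‖y‖ ∧ ‖y‖ < 2 * R} (fun y => jbr (‖x‖ - ‖y‖) ^ (-1 : ℝ)) := by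
      ext y; simp [Set.indicator]
    rw [e] at this
    rw [this]
    simp only [finrank_euclideanSpace, Fintype.card_fin, smul_eq_mul, nsmul_eq_mul]
    rw [intervalIntegral.integral_of_le (by linarith), integral_Ioc_eq_integral_Ioo,
      ← integral_indicator measurableSet_Ioo, ← integral_indicator measurableSet_Ioi]
    rw [← hω]
    have e' : ∀ r : ℝ, (Set.Ioi (0:ℝ)).indicator (fun y => y ^ (4-1) * (Set.Ioo R (2*R)).indicator (fun r : ℝ => jbr (‖x‖ - r) ^ (-1 : ℝ)) y) r = (Set.Ioo R (2*R)).indicator (fun r : ℝ => r ^ 3 * jbr (‖x‖ - r) ^ (-1 : ℝ)) r := by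
      intro r
      by_cases hr : r ∈ Set.Ioo R (2*R)
      · have : r ∈ Set.Ioi (0:ℝ) := by have := hr.1; simp; linarith
        simp [hr, Set.indicator_of_mem this]
      · simp [Set.indicator, hr]
    simp only [e']
    push_cast
    ring
  rw [integral_const_mul, e1]
  have e2 : R ^ 3 * Real.log (1 + R) ≤ ∫ r in R..(2*R), r ^ 3 * jbr (‖x‖ - r) ^ (-1 : ℝ) := by
    calc R ^ 3 * Real.log (1 + R) ≤ R ^ 3 * ∫ r in R..(2*R), jbr (‖x‖ - r) ^ (-1 : ℝ) := by
          gcongr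
          rw [int_ker6]
          have a1 := arsinh_ge6 (2 * R - ‖x‖) (by linarith)
          have a2 := arsinh_ge6 (‖x‖ - R) (by linarith)
          have a3 : Real.log (1 + R) ≤ Real.log ((1 + (2 * R - ‖x‖)) * (1 + (‖x‖ - R))) := by
            apply Real.log_le_log (by linarith)
            nlinarith
          rw [Real.log_mul (by linarith) (by linarith)] at a3
          linarith
      _ = ∫ r in R..(2*R), R ^ 3 * jbr (‖x‖ - r) ^ (-1 : ℝ) := by
          rw [intervalIntegral.integral_const_mul]
      _ ≤ _ := by
          apply intervalIntegral.integral_mono_on (by linarith)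
          · exact (continuous_const.mul hcont).intervalIntegrable _ _
          · exact ((continuous_id.pow 3).mul hcont).intervalIntegrable _ _
          · intro r hr
            have := hr.1
            have := (Real.rpow_pos_of_pos (jbr_pos6 (‖x‖ - r)) (-1)).le
            gcongr
  have e3 : Real.log (jbr R) ≤ Real.log (1 + R) := by
    apply Real.log_le_log (jbr_pos6 R)
    rw [jbr, Real.sqrt_le_left (by linarith)]
    nlinarith
  have e4 : (27 * R ^ 3)⁻¹ ≤ jb x ^ (-3 : ℝ) := by
    have hp : 0 < jb x := Real.sqrt_pos.2 (by positivity)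
    rw [Real.rpow_neg hp.le, show (3:ℝ) = ((3:ℕ):ℝ) by norm_num, Real.rpow_natCast]
    have : jb x ≤ 3 * R := by
      rw [jb, Real.sqrt_le_left (by linarith)]
      nlinarith
    rw [show (27 * R ^ 3 : ℝ) = (3 * R) ^ 3 by ring]
    gcongr
  have hl : 0 ≤ Real.log (1 + R) := Real.log_nonneg (by linarith)
  calc 4 * ω / 27 * Real.log (jbr R) ≤ 4 * ω / 27 * Real.log (1 + R) := by gcongr
    _ = (27 * R ^ 3)⁻¹ * (4 * ω * (R ^ 3 * Real.log (1 + R))) := by field_simp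
    _ ≤ _ := by
      have h0 : 0 ≤ jb x ^ (-3 : ℝ) := le_trans (by positivity) e4
      gcongr

theorem stmt_6 :
    (∃ c : ℝ, 0 < c ∧ ∀ R : ℝ, 1 < R → ∀ x : EuclideanSpace ℝ (Fin 4),
      R < ‖x‖ → ‖x‖ < 2 * R →
        c * Real.log (jbr R) ≤
          ∫ y in {y : EuclideanSpace ℝ (Fin 4) | R < ‖y‖ ∧ ‖y‖ < 2 * R},
            jb x ^ (-3 : ℝ) * jbr (‖x‖ - ‖y‖) ^ (-1 : ℝ)) ∧
    ∀ p : ℝ≥0∞, 1 ≤ p →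
      ¬ ∃ C' : ℝ,
        ∀ f : EuclideanSpace ℝ (Fin 4) → ℂ, MemLp f p volume →
          eLpNorm (fun x => ∫ y, (K6 x y : ℂ) * f y) p volume ≤
            ENNReal.ofReal C' * eLpNorm f p volume := by
  have hω : 0 < 4 * volume.real (Metric.ball (0 : EuclideanSpace ℝ (Fin 4)) 1) / 27 := by
    have : 0 < volume.real (Metric.ball (0 : EuclideanSpace ℝ (Fin 4)) 1) :=
      ENNReal.toReal_pos (Metric.measure_ball_pos _ _ one_pos).ne' measure_ball_lt_top.ne
    positivity
  refine ⟨⟨_, hω, main6⟩, ?_⟩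
  rintro p hp ⟨C, hC⟩
  set c := 4 * volume.real (Metric.ball (0 : EuclideanSpace ℝ (Fin 4)) 1) / 27 with hc
  -- choose R
  obtain ⟨R, hR, hRC⟩ : ∃ R : ℝ, 1 < R ∧ max C 0 < c * Real.log (jbr R) := by
    refine ⟨Real.exp ((max C 0 + 1) / c), ?_, ?_⟩
    · rw [Real.one_lt_exp_iff]
      have := le_max_right C 0
      positivity
    · set M := max C 0
      have h1 : (M + 1) / c ≤ Real.log (jbr (Real.exp ((M + 1) / c))) := by
        rw [Real.le_log_iff_exp_le (jbr_pos6 _), jbr]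
        apply Real.le_sqrt_of_sq_le
        linarith
      rw [div_le_iff₀ hω] at h1
      linarith
  set A := {y : EuclideanSpace ℝ (Fin 4) | R < ‖y‖ ∧ ‖y‖ < 2 * R} with hA
  have hm : MeasurableSet A := by
    rw [hA]; measurability
  have hAo : IsOpen A :=
    (isOpen_lt continuous_const continuous_norm).inter (isOpen_lt continuous_norm continuous_const)
  have hAfin : volume A ≠ ∞ := by
    refine ((measure_mono ?_).trans_lt (measure_ball_lt_top (x := (0 : EuclideanSpace ℝ (Fin 4))) (r := 2 * R))).ne
    intro y hy
    simpa using hy.2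
  have hAne : A.Nonempty := by
    refine ⟨EuclideanSpace.single 0 (3 / 2 * R), ?_⟩
    simp only [hA, Set.mem_setOf_eq, EuclideanSpace.norm_single, Real.norm_eq_abs]
    rw [abs_of_pos (by linarith)]
    constructor <;> linarith
  have hA0 : volume A ≠ 0 := (hAo.measure_pos volume hAne).ne'
  set f : EuclideanSpace ℝ (Fin 4) → ℂ := A.indicator (fun _ => 1) with hf
  have hfm : MemLp f p volume := memLp_indicator_const p hm 1 (Or.inr hAfin)
  have hT := hC f hfm
  set L := c * Real.log (jbr R)
  have hL : 0 < L := (le_max_right C 0).trans_lt hRC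
  have hlow : eLpNorm ((L : ℝ) • f) p volume ≤ eLpNorm (fun x => ∫ y, (K6 x y : ℂ) * f y) p volume := by
    apply eLpNorm_mono
    intro x
    by_cases hx : x ∈ A
    · have e : ∫ y, (K6 x y : ℂ) * f y = ((∫ y in A, jb x ^ (-3 : ℝ) * jbr (‖x‖ - ‖y‖) ^ (-1 : ℝ) : ℝ) : ℂ) := by
        rw [← integral_complex_ofReal, ← integral_indicator hm]
        congr 1
        ext1 y
        by_cases hy : y ∈ A
        · have : ‖x‖ / 2 ≤ ‖y‖ ∧ ‖y‖ ≤ 2 * ‖x‖ := by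
            have := hx.1; have := hx.2; have := hy.1; have := hy.2
            constructor <;> linarith
          simp only [hf, Set.indicator_of_mem hy, K6, if_pos this, mul_one]
        · simp [hf, Set.indicator_of_notMem hy]
      rw [e, Complex.norm_real]
      have h := main6 R hR x hx.1 hx.2
      simp only [Pi.smul_apply, hf, Set.indicator_of_mem hx, norm_smul, norm_one, mul_one]
      rw [Real.norm_of_nonneg hL.le]
      exact h.trans (Real.le_norm_self _)
    · simp [hf, Set.indicator_of_notMem hx]
  rw [eLpNorm_const_smul] at hlow
  have hf0 : eLpNorm f p volume ≠ 0 := by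
    rw [Ne, eLpNorm_eq_zero_iff hfm.1 (by positivity), hf, Set.indicator_ae_eq_zero]
    have : Function.support (fun _ : EuclideanSpace ℝ (Fin 4) => (1 : ℂ)) = Set.univ := by
      ext; simp
    rw [this, Set.inter_univ]
    exact hA0
  have h := (ENNReal.mul_le_mul_iff_left hf0 hfm.2.ne).1 (hlow.trans hT)
  rw [Real.enorm_eq_ofReal hL.le, ENNReal.ofReal_le_ofReal_iff'] at h
  rcases h with h | h
  · exact absurd ((le_max_left C 0).trans_lt hRC) (not_lt.2 h)
  · exact absurd hL (not_lt.2 h)
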